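/- Let d ≥ 2 and let P_{C,r} be a basic r-ball polyhedron in E^d with center-polytope conv(C). If S, S' ⊆ C satisfy V_S ∩ bd(P_{C,r}) ≠ ∅ and V_{S'} ∩ bd(P_{C,r}) ≠ ∅, then the intersection of the corresponding closed faces (cl(V_S) ∩ bd(P_{C,r})) ∩ (cl(V_{S'}) ∩ bd(P_{C,r})) is either empty or equal to cl(V_{S''}) ∩ bd(P_{C,r}) for some S'' ⊆ C with V_{S''} ∩ bd(P_{C,r}) ≠ ∅; consequently the closed faces of P_{C,r} together with ∅ and P_{C,r} form a lattice under inclusion. -/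

import Mathlib

open Metric Set
open scoped RealInnerProductSpace

/-- The dimension of a set: the dimension of its affine span. -/
noncomputable def setDim {d : ℕ} (A : Set (EuclideanSpace ℝ (Fin d))) : ℕ :=
  Module.finrank ℝ (affineSpan ℝ A).direction

/-- The farthest-point Voronoi face `V_S`: the set of points whose set of farthest points
of `C` is exactly `S`. -/
def vorF {d : ℕ} (C S : Set (EuclideanSpace ℝ (Fin d))) : Set (EuclideanSpace ℝ (Fin d)) :=
  {x | S = {c | c ∈ C ∧ ∀ c' ∈ C, dist x c' ≤ dist x c}}

/-- `P_{C,r}`: the intersection of the closed balls of radius `r` centered at points of `C`. -/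
def ballPoly {d : ℕ} (C : Set (EuclideanSpace ℝ (Fin d))) (r : ℝ) :
    Set (EuclideanSpace ℝ (Fin d)) :=
  ⋂ c ∈ C, closedBall c r

/-- The `r`-convex hull of `X`. -/
def rConvexHull {d : ℕ} (r : ℝ) (X : Set (EuclideanSpace ℝ (Fin d))) :
    Set (EuclideanSpace ℝ (Fin d)) :=
  ⋂ x ∈ {x | X ⊆ closedBall x r}, closedBall x r

/-- `C` lies in `r`-convex position. -/
def RConvexPosition {d : ℕ} (r : ℝ) (C : Set (EuclideanSpace ℝ (Fin d))) : Prop :=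
  (∃ p, C ⊆ ball p r) ∧ ∀ c ∈ C, c ∉ rConvexHull r (C \ {c})

/-- `P_{C,r}` is a basic `r`-ball polyhedron with center-polytope `conv C`. -/
def IsBasicBallPolyhedron {d : ℕ} (C : Set (EuclideanSpace ℝ (Fin d))) (r : ℝ) : Prop :=
  0 < r ∧ C.Finite ∧ d + 1 ≤ C.ncard ∧ 2 ≤ d ∧
  setDim (convexHull ℝ C) = d ∧
  C = Set.extremePoints ℝ (convexHull ℝ C) ∧
  RConvexPosition r C ∧
  ∀ S ⊆ C, ∀ v, vorF C S = {v} → v ∈ interior (ballPoly C r)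

/-- `fFace C r k` is the number of `(k-1)`-dimensional faces of `P_{C,r}`, i.e. the number of
`S ⊆ C` with `V_S ∩ bd(P_{C,r}) ≠ ∅` and `dim V_S = k`. -/
noncomputable def fFace {d : ℕ} (C : Set (EuclideanSpace ℝ (Fin d))) (r : ℝ) (k : ℕ) : ℕ :=
  {S : Set (EuclideanSpace ℝ (Fin d)) | S ⊆ C ∧
    (vorF C S ∩ frontier (ballPoly C r)).Nonempty ∧ setDim (vorF C S) = k}.ncard

/-- The collection of closed faces of the basic `r`-ball polyhedron `P_{C,r}`. -/
def closedFaces {d : ℕ} (C : Set (EuclideanSpace ℝ (Fin d))) (r : ℝ) :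
    Set (Set (EuclideanSpace ℝ (Fin d))) :=
  {F | ∃ S, S ⊆ C ∧ (vorF C S ∩ frontier (ballPoly C r)).Nonempty ∧
    F = closure (vorF C S) ∩ frontier (ballPoly C r)}

/-- The points of `C` farthest from `x`. -/
def farSet {d : ℕ} (C : Set (EuclideanSpace ℝ (Fin d))) (x : EuclideanSpace ℝ (Fin d)) :
    Set (EuclideanSpace ℝ (Fin d)) :=
  {c | c ∈ C ∧ ∀ c' ∈ C, dist x c' ≤ dist x c}

/-- The difference of the squared distances from `x` to `c` and to `c₀`; it is affine in `x`. -/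
noncomputable def powerDiff {d : ℕ} (c₀ c x : EuclideanSpace ℝ (Fin d)) : ℝ :=
  dist x c ^ 2 - dist x c₀ ^ 2

section FarthestPoints

variable {d : ℕ} {C S T : Set (EuclideanSpace ℝ (Fin d))} {r : ℝ}
  {c₀ c x y z : EuclideanSpace ℝ (Fin d)}

lemma mem_vorF : x ∈ vorF C S ↔ S = farSet C x := Iff.rfl

lemma farSet_subset : farSet C x ⊆ C := fun _ h => h.1

lemma farSet_nonempty (hfin : C.Finite) (hne : C.Nonempty) : (farSet C x).Nonempty := by
  obtain ⟨c, hc, h⟩ := Set.exists_max_image C (fun c => dist x c) hfin hne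
  exact ⟨c, hc, h⟩

lemma powerDiff_eq (c₀ c x : EuclideanSpace ℝ (Fin d)) :
    powerDiff c₀ c x = -2 * ⟪x, c - c₀⟫ + (‖c‖ ^ 2 - ‖c₀‖ ^ 2) := by
  simp only [powerDiff, dist_eq_norm, norm_sub_sq_real, inner_sub_right]
  ring

lemma powerDiff_lineMap (c₀ c x y : EuclideanSpace ℝ (Fin d)) (t : ℝ) :
    powerDiff c₀ c (AffineMap.lineMap x y t) =
      powerDiff c₀ c x + t * (powerDiff c₀ c y - powerDiff c₀ c x) := by
  simp only [powerDiff_eq, AffineMap.lineMap_apply_module', inner_add_left, inner_smul_left,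
    inner_sub_left]
  simp
  ring

lemma powerDiff_nonpos : powerDiff c₀ c x ≤ 0 ↔ dist x c ≤ dist x c₀ := by
  rw [powerDiff, sub_nonpos, sq_le_sq₀ dist_nonneg dist_nonneg]

lemma powerDiff_eq_zero : powerDiff c₀ c x = 0 ↔ dist x c = dist x c₀ := by
  rw [powerDiff, sub_eq_zero, sq_eq_sq₀ dist_nonneg dist_nonneg]

lemma mem_farSet_iff : c₀ ∈ farSet C x ↔ c₀ ∈ C ∧ ∀ c ∈ C, powerDiff c₀ c x ≤ 0 := by
  simp only [farSet, mem_ofPred_eq, powerDiff_nonpos]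

lemma mem_farSet_iff_of_mem (h₀ : c₀ ∈ farSet C x) :
    c ∈ farSet C x ↔ c ∈ C ∧ powerDiff c₀ c x = 0 := by
  rw [powerDiff_eq_zero]
  constructor
  · exact fun h => ⟨h.1, le_antisymm (h₀.2 c h.1) (h.2 c₀ h₀.1)⟩
  · exact fun h => ⟨h.1, fun c₁ hc₁ => h.2 ▸ h₀.2 c₁ hc₁⟩

/-- Strictly between two points with a common farthest point, exactly the common farthest points
are farthest. -/
lemma farSet_lineMap (hx : c₀ ∈ farSet C x) (hy : c₀ ∈ farSet C y) {t : ℝ} (h0 : 0 < t)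
    (h1 : t < 1) : farSet C (AffineMap.lineMap x y t) = farSet C x ∩ farSet C y := by
  have hx' := (mem_farSet_iff.1 hx).2
  have hy' := (mem_farSet_iff.1 hy).2
  have key : c₀ ∈ farSet C (AffineMap.lineMap x y t) := by
    refine mem_farSet_iff.2 ⟨hx.1, fun c hc => ?_⟩
    rw [powerDiff_lineMap]
    nlinarith [hx' c hc, hy' c hc]
  ext c
  rw [mem_inter_iff, mem_farSet_iff_of_mem key, mem_farSet_iff_of_mem hx,
    mem_farSet_iff_of_mem hy, powerDiff_lineMap]
  constructor
  · rintro ⟨hc, h⟩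
    have h2 := hx' c hc
    have h3 := hy' c hc
    refine ⟨⟨hc, ?_⟩, hc, ?_⟩ <;> nlinarith
  · rintro ⟨⟨hc, h2⟩, -, h3⟩
    exact ⟨hc, by rw [h2, h3]; ring⟩

lemma isClosed_setOf_subset_farSet (S : Set (EuclideanSpace ℝ (Fin d))) :
    IsClosed {x | S ⊆ farSet C x} := by
  have : {x | S ⊆ farSet C x} =
      ⋂ c ∈ S, {x | c ∈ C} ∩ ⋂ c' ∈ C, {x | dist x c' ≤ dist x c} := by
    ext x
    simp [farSet, Set.subset_def]
  rw [this]
  refine isClosed_biInter fun c _ => isClosed_const.inter (isClosed_biInter fun c' _ => ?_)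
  exact isClosed_le (by fun_prop) (by fun_prop)

lemma closure_vorF (hx : x ∈ vorF C S) (hS : S.Nonempty) :
    closure (vorF C S) = {z | S ⊆ farSet C z} := by
  rw [mem_vorF] at hx
  refine Subset.antisymm
    (closure_minimal (fun z hz => (mem_vorF.1 hz).subset) (isClosed_setOf_subset_farSet S)) ?_
  intro z hz
  obtain ⟨c₀, h₀⟩ := hS
  have hmem : ∀ t ∈ Ioo (0 : ℝ) 1, AffineMap.lineMap z x t ∈ vorF C S := by
    intro t ht
    rw [mem_vorF, farSet_lineMap (hz h₀) (hx ▸ h₀) ht.1 ht.2, ← hx,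
      inter_eq_self_of_subset_right hz]
  have hcont : Continuous fun t : ℝ => AffineMap.lineMap z x t :=
    AffineMap.lineMap_continuous
  have h0 : (0 : ℝ) ∈ closure (Ioo (0 : ℝ) 1) := by
    rw [closure_Ioo zero_ne_one]
    simp
  have := map_mem_closure hcont h0 hmem
  simpa using this

/-- Some point of a nonempty `{z | T ⊆ farSet C z}` has the smallest set of farthest points. -/
lemma exists_farSet_minimal (hfin : C.Finite) (hT : T.Nonempty) (hx : T ⊆ farSet C x) :
    ∃ y, T ⊆ farSet C y ∧ ∀ z, T ⊆ farSet C z → farSet C y ⊆ farSet C z := by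
  obtain ⟨c₀, h₀⟩ := hT
  have hfin' : (farSet C '' {z | T ⊆ farSet C z}).Finite :=
    hfin.finite_subsets.subset (by rintro _ ⟨z, -, rfl⟩; exact farSet_subset)
  obtain ⟨y, hy, hmin⟩ := hfin'.exists_minimalFor' (farSet C) _ ⟨x, hx⟩
  refine ⟨y, hy, fun z hz => ?_⟩
  have hm := farSet_lineMap (hy h₀) (hz h₀) (t := 1 / 2) (by norm_num) (by norm_num)
  have h1 : T ⊆ farSet C (AffineMap.lineMap y z (1 / 2 : ℝ)) := by
    rw [hm]
    exact subset_inter hy hz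
  have h2 := hmin h1 (by rw [hm]; exact inter_subset_left)
  exact (h2.trans hm.subset).trans inter_subset_right

/-- A point whose set of farthest points is maximal can not be moved along a line on which some
power difference increases and those of its farthest points vanish. -/
lemma exists_farSet_ssubset (hfin : C.Finite) (h₀ : c₀ ∈ farSet C x)
    (hy : ∀ c ∈ farSet C x, powerDiff c₀ c y = 0)
    (hinc : ∃ c ∈ C, powerDiff c₀ c x < powerDiff c₀ c y) :
    ∃ z, farSet C x ⊂ farSet C z := by
  have hx := (mem_farSet_iff.1 h₀).2
  obtain ⟨c₁, ⟨hc₁, hlt⟩, hmin⟩ := Set.exists_min_image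
    {c | c ∈ C ∧ powerDiff c₀ c x < powerDiff c₀ c y}
    (fun c => -powerDiff c₀ c x / (powerDiff c₀ c y - powerDiff c₀ c x))
    (hfin.subset fun _ h => h.1) hinc
  set t := -powerDiff c₀ c₁ x / (powerDiff c₀ c₁ y - powerDiff c₀ c₁ x) with ht
  have ht0 : 0 ≤ t := div_nonneg (by linarith [hx c₁ hc₁]) (by linarith)
  have hz : c₀ ∈ farSet C (AffineMap.lineMap x y t) := by
    refine mem_farSet_iff.2 ⟨h₀.1, fun c hc => ?_⟩
    rw [powerDiff_lineMap]
    by_cases h : powerDiff c₀ c x < powerDiff c₀ c y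
    · have := hmin c ⟨hc, h⟩
      rw [le_div_iff₀ (by linarith)] at this
      linarith
    · nlinarith [hx c hc]
  refine ⟨AffineMap.lineMap x y t, ?_, fun hsub => ?_⟩
  · intro c hc
    rw [mem_farSet_iff_of_mem hz, powerDiff_lineMap, hy c hc,
      ((mem_farSet_iff_of_mem h₀).1 hc).2]
    exact ⟨hc.1, by ring⟩
  · have h1 : c₁ ∈ farSet C (AffineMap.lineMap x y t) := by
      rw [mem_farSet_iff_of_mem hz, powerDiff_lineMap, ht,
        div_mul_cancel₀ _ (by linarith : powerDiff c₀ c₁ y - powerDiff c₀ c₁ x ≠ 0)]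
      exact ⟨hc₁, by ring⟩
    have h2 := hsub h1
    linarith [hy c₁ h2, ((mem_farSet_iff_of_mem h₀).1 h2).2]

lemma eq_of_powerDiff_eq (hdim : setDim (convexHull ℝ C) = d) (h₀ : c₀ ∈ C)
    (h : ∀ c ∈ C, powerDiff c₀ c x = powerDiff c₀ c y) : x = y := by
  rw [setDim, affineSpan_convexHull, direction_affineSpan] at hdim
  have htop : vectorSpan ℝ C = ⊤ := Submodule.eq_top_of_finrank_eq (by simpa using hdim)
  rw [vectorSpan_eq_span_vsub_set_right ℝ h₀] at htop
  have hle : Submodule.span ℝ ((· -ᵥ c₀) '' C) ≤ (ℝ ∙ (x - y))ᗮ := by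
    rw [Submodule.span_le]
    rintro _ ⟨c, hc, rfl⟩
    have := h c hc
    rw [powerDiff_eq, powerDiff_eq] at this
    rw [SetLike.mem_coe, Submodule.mem_orthogonal_singleton_iff_inner_right]
    simp only [vsub_eq_sub, inner_sub_left]
    linarith
  rw [htop] at hle
  have hmem := hle (Submodule.mem_top (x := x - y))
  rw [Submodule.mem_orthogonal_singleton_iff_inner_right, inner_self_eq_zero, sub_eq_zero] at hmem
  exact hmem

/-- Every nonempty `{z | T ⊆ farSet C z}` contains a vertex of the farthest-point Voronoi
diagram. -/
lemma exists_vertex (hfin : C.Finite) (hne : C.Nonempty) (hdim : setDim (convexHull ℝ C) = d)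
    (hx : T ⊆ farSet C x) : ∃ v, T ⊆ farSet C v ∧ vorF C (farSet C v) = {v} := by
  have hfin' : (farSet C '' {z | T ⊆ farSet C z}).Finite :=
    hfin.finite_subsets.subset (by rintro _ ⟨z, -, rfl⟩; exact farSet_subset)
  obtain ⟨v, hv, hmax⟩ := hfin'.exists_maximalFor' (farSet C) _ ⟨x, hx⟩
  refine ⟨v, hv, Subset.antisymm (fun y hy => ?_) (singleton_subset_iff.2 rfl)⟩
  rw [mem_vorF] at hy
  obtain ⟨c₀, h₀⟩ := farSet_nonempty (x := v) hfin hne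
  by_contra hyv
  have hmax' : ¬ ∃ z, farSet C v ⊂ farSet C z := by
    rintro ⟨z, hz⟩
    exact hz.2 (hmax (hv.trans hz.1) hz.1)
  have hzero : ∀ c ∈ farSet C v, powerDiff c₀ c v = 0 ∧ powerDiff c₀ c y = 0 := fun c hc =>
    ⟨((mem_farSet_iff_of_mem h₀).1 hc).2, ((mem_farSet_iff_of_mem (hy ▸ h₀)).1 (hy ▸ hc)).2⟩
  refine hyv (eq_of_powerDiff_eq hdim h₀.1 fun c hc => le_antisymm ?_ ?_) <;> by_contra! hlt
  · exact hmax' (exists_farSet_ssubset hfin h₀ (fun c hc => (hzero c hc).2) ⟨c, hc, hlt⟩)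
  · refine hmax' (exists_farSet_ssubset (y := AffineMap.lineMap v y (-1 : ℝ)) hfin h₀
      (fun c hc => ?_) ⟨c, hc, ?_⟩)
    · rw [powerDiff_lineMap, (hzero c hc).1, (hzero c hc).2]
      ring
    · rw [powerDiff_lineMap]
      linarith

/-- If the face of `x` contains a further point, then `{z | farSet C x ⊆ farSet C z}` contains
points farther from `c₀` than `x`. -/
lemma exists_dist_lt (hfin : C.Finite) (h₀ : c₀ ∈ farSet C x) (hxy : farSet C x = farSet C y)
    (hne : y ≠ x) : ∃ w, farSet C x ⊆ farSet C w ∧ dist x c₀ < dist w c₀ := by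
  have hev : ∀ᶠ t : ℝ in nhds 0, ∀ c ∈ C \ farSet C x,
      powerDiff c₀ c (AffineMap.lineMap x y t) < 0 := by
    rw [Filter.eventually_all_finite (hfin.subset sdiff_subset)]
    intro c hc
    have hlt : powerDiff c₀ c x < 0 := by
      refine lt_of_le_of_ne ((mem_farSet_iff.1 h₀).2 c hc.1) fun h => hc.2 ?_
      exact (mem_farSet_iff_of_mem h₀).2 ⟨hc.1, h⟩
    have hcont : Continuous fun t : ℝ => powerDiff c₀ c (AffineMap.lineMap x y t) := by
      simp only [powerDiff_lineMap]
      fun_prop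
    refine hcont.continuousAt.eventually_lt continuousAt_const ?_
    simpa using hlt
  have hsub : ∀ t : ℝ, (∀ c ∈ C \ farSet C x, powerDiff c₀ c (AffineMap.lineMap x y t) < 0) →
      farSet C x ⊆ farSet C (AffineMap.lineMap x y t) := by
    intro t ht
    have hz : ∀ c ∈ farSet C x, powerDiff c₀ c (AffineMap.lineMap x y t) = 0 := by
      intro c hc
      rw [powerDiff_lineMap, ((mem_farSet_iff_of_mem h₀).1 hc).2,
        ((mem_farSet_iff_of_mem (hxy ▸ h₀)).1 (hxy ▸ hc)).2]
      ring
    have h1 : c₀ ∈ farSet C (AffineMap.lineMap x y t) := by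
      refine mem_farSet_iff.2 ⟨h₀.1, fun c hc => ?_⟩
      by_cases h : c ∈ farSet C x
      · exact (hz c h).le
      · exact (ht c ⟨hc, h⟩).le
    exact fun c hc => (mem_farSet_iff_of_mem h1).2 ⟨hc.1, hz c hc⟩
  obtain ⟨ε, hε, hball⟩ := Metric.eventually_nhds_iff.1 hev
  have h1 := hsub (ε / 2) (hball (by rw [Real.dist_0_eq_abs, abs_of_pos] <;> linarith))
  have h2 := hsub (-(ε / 2))
    (hball (by rw [Real.dist_0_eq_abs, abs_neg, abs_of_pos] <;> linarith))
  by_contra! hcon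
  have h3 := hcon _ h1
  have h4 := hcon _ h2
  have e1 : AffineMap.lineMap x y (ε / 2) - c₀ = (x - c₀) + (ε / 2) • (y - x) := by
    rw [AffineMap.lineMap_apply_module']
    abel
  have e2 : AffineMap.lineMap x y (-(ε / 2)) - c₀ = (x - c₀) - (ε / 2) • (y - x) := by
    rw [AffineMap.lineMap_apply_module', neg_smul]
    abel
  rw [dist_eq_norm, dist_eq_norm, e1] at h3
  rw [dist_eq_norm, dist_eq_norm, e2] at h4
  have hpar := parallelogram_law_with_norm ℝ (x - c₀) ((ε / 2) • (y - x))
  have hpos : 0 < ‖(ε / 2) • (y - x)‖ :=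
    norm_pos_iff.2 (smul_ne_zero (by linarith) (sub_ne_zero.2 hne))
  nlinarith [norm_nonneg (x - c₀ + (ε / 2) • (y - x)), norm_nonneg (x - c₀ - (ε / 2) • (y - x)),
    norm_nonneg (x - c₀)]

/-- The open segment between two points with a common farthest point `c₀`, on different sides of
a sphere about `c₀`, meets that sphere. -/
lemma exists_lineMap_dist_eq (hx : dist x c₀ < r ∧ r < dist y c₀ ∨ r < dist x c₀ ∧ dist y c₀ < r) :
    ∃ t : ℝ, 0 < t ∧ t < 1 ∧ dist (AffineMap.lineMap x y t : EuclideanSpace ℝ (Fin d)) c₀ = r := by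
  have hcont : Continuous fun t : ℝ =>
      dist (AffineMap.lineMap x y t : EuclideanSpace ℝ (Fin d)) c₀ :=
    AffineMap.lineMap_continuous.dist continuous_const
  rcases hx with h | h
  · obtain ⟨t, ht, h'⟩ := intermediate_value_Ioo zero_le_one hcont.continuousOn
      (show r ∈ Ioo _ _ by simpa using h)
    exact ⟨t, ht.1, ht.2, h'⟩
  · obtain ⟨t, ht, h'⟩ := intermediate_value_Ioo' zero_le_one hcont.continuousOn
      (show r ∈ Ioo _ _ by simpa using h.symm)
    exact ⟨t, ht.1, ht.2, h'⟩

lemma isClosed_ballPoly : IsClosed (ballPoly C r) :=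
  isClosed_biInter fun _ _ => isClosed_closedBall

lemma interior_ballPoly (hfin : C.Finite) (hr : r ≠ 0) :
    interior (ballPoly C r) = ⋂ c ∈ C, ball c r := by
  rw [ballPoly, hfin.interior_biInter]
  simp only [interior_closedBall _ hr]

lemma mem_frontier_ballPoly (hfin : C.Finite) (hr : r ≠ 0) (h₀ : c₀ ∈ farSet C x) :
    x ∈ frontier (ballPoly C r) ↔ dist x c₀ = r := by
  rw [isClosed_ballPoly.frontier_eq, interior_ballPoly hfin hr, mem_sdiff, ballPoly]
  simp only [mem_iInter, mem_closedBall, mem_ball]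
  constructor
  · rintro ⟨h1, h2⟩
    refine le_antisymm (h1 c₀ h₀.1) ?_
    by_contra! h3
    exact h2 fun c hc => (h₀.2 c hc).trans_lt h3
  · intro h
    exact ⟨fun c hc => (h₀.2 c hc).trans h.le, fun h2 => (h2 c₀ h₀.1).ne h⟩

end FarthestPoints

section BasicBallPolyhedron

variable {d : ℕ} {C T : Set (EuclideanSpace ℝ (Fin d))} {r : ℝ} {x : EuclideanSpace ℝ (Fin d)}

lemma IsBasicBallPolyhedron.nonempty (hC : IsBasicBallPolyhedron C r) : C.Nonempty := by
  obtain ⟨-, hfin, hcard, -⟩ := hC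
  exact (Set.ncard_pos hfin).1 (by omega)

lemma IsBasicBallPolyhedron.inter_frontier_mem_closedFaces (hC : IsBasicBallPolyhedron C r)
    (hT : T.Nonempty) (hx : T ⊆ farSet C x) (hxP : x ∈ frontier (ballPoly C r)) :
    {z | T ⊆ farSet C z} ∩ frontier (ballPoly C r) ∈ closedFaces C r := by
  have hne := hC.nonempty
  obtain ⟨hr, hfin, -, -, hdim, -, -, hvert⟩ := hC
  obtain ⟨c₀, h₀⟩ := hT
  obtain ⟨y, hy, hmin⟩ := exists_farSet_minimal hfin ⟨c₀, h₀⟩ hx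
  have hset : {z | T ⊆ farSet C z} = {z | farSet C y ⊆ farSet C z} :=
    Subset.antisymm (fun z hz => hmin z hz) fun z hz => hy.trans hz
  refine ⟨farSet C y, farSet_subset, ?_, ?_⟩
  swap
  · rw [hset, closure_vorF (mem_vorF.2 rfl : y ∈ vorF C (farSet C y)) ⟨c₀, hy h₀⟩]
  suffices ∃ m, farSet C m = farSet C y ∧ dist m c₀ = r by
    obtain ⟨m, hm, hmr⟩ := this
    exact ⟨m, hm.symm, (mem_frontier_ballPoly hfin hr.ne' (hm ▸ hy h₀)).2 hmr⟩
  have hseg : ∀ w, T ⊆ farSet C w →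
      (dist y c₀ < r ∧ r < dist w c₀ ∨ r < dist y c₀ ∧ dist w c₀ < r) →
      ∃ m, farSet C m = farSet C y ∧ dist m c₀ = r := by
    intro w hw h
    obtain ⟨t, ht0, ht1, ht⟩ := exists_lineMap_dist_eq h
    refine ⟨_, ?_, ht⟩
    rw [farSet_lineMap (hy h₀) (hw h₀) ht0 ht1]
    exact inter_eq_self_of_subset_left (hmin w hw)
  rw [mem_frontier_ballPoly hfin hr.ne' (hx h₀)] at hxP
  rcases lt_trichotomy (dist y c₀) r with h | h | h
  · have hxv : ¬ vorF C (farSet C x) = {x} := by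
      intro hv
      have := hvert _ farSet_subset x hv
      rw [interior_ballPoly hfin hr.ne'] at this
      exact (mem_iInter₂.1 this c₀ (hx h₀).1).ne hxP
    have : ∃ y' ∈ vorF C (farSet C x), y' ≠ x := by
      by_contra! hcon
      exact hxv (Subset.antisymm hcon (singleton_subset_iff.2 rfl))
    obtain ⟨y', hy', hne'⟩ := this
    obtain ⟨w, hw, hwlt⟩ := exists_dist_lt hfin (hx h₀) hy' hne'
    exact hseg w (hx.trans hw) (Or.inl ⟨h, hxP ▸ hwlt⟩)
  · exact ⟨y, rfl, h⟩
  · obtain ⟨v, hv, hvv⟩ := exists_vertex hfin hne hdim hx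
    have := hvert _ farSet_subset v hvv
    rw [interior_ballPoly hfin hr.ne'] at this
    exact hseg v hv (Or.inr ⟨h, mem_iInter₂.1 this c₀ (hv h₀).1⟩)

lemma IsBasicBallPolyhedron.inter_closedFace (hC : IsBasicBallPolyhedron C r)
    {F F' : Set (EuclideanSpace ℝ (Fin d))} (hF : F ∈ closedFaces C r)
    (hF' : F' ∈ closedFaces C r) : F ∩ F' = ∅ ∨ F ∩ F' ∈ closedFaces C r := by
  obtain ⟨S, -, ⟨x, hx, -⟩, rfl⟩ := hF
  obtain ⟨S', -, ⟨x', hx', -⟩, rfl⟩ := hF'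
  have hS : S.Nonempty := (mem_vorF.1 hx) ▸ farSet_nonempty hC.2.1 hC.nonempty
  have hS' : S'.Nonempty := (mem_vorF.1 hx') ▸ farSet_nonempty hC.2.1 hC.nonempty
  rw [closure_vorF hx hS, closure_vorF hx' hS', ← inter_inter_distrib_right]
  have : {z | S ⊆ farSet C z} ∩ {z | S' ⊆ farSet C z} = {z | S ∪ S' ⊆ farSet C z} := by
    ext z
    simp
  rw [this]
  refine (Set.eq_empty_or_nonempty _).imp_right ?_
  rintro ⟨z, hz, hzP⟩
  exact hC.inter_frontier_mem_closedFaces hS.inl hz hzP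

lemma finite_closedFaces (hfin : C.Finite) : (closedFaces C r).Finite := by
  refine (hfin.finite_subsets.image
    fun S => closure (vorF C S) ∩ frontier (ballPoly C r)).subset ?_
  rintro _ ⟨S, hS, -, rfl⟩
  exact ⟨S, hS, rfl⟩

lemma subset_ballPoly_of_mem_closedFaces {F : Set (EuclideanSpace ℝ (Fin d))}
    (hF : F ∈ closedFaces C r ∪ {∅, ballPoly C r}) : F ⊆ ballPoly C r := by
  rcases hF with ⟨S, -, -, rfl⟩ | rfl | rfl
  · exact inter_subset_right.trans isClosed_ballPoly.frontier_subset
  · exact empty_subset _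
  · exact Subset.rfl

lemma IsBasicBallPolyhedron.inter_mem (hC : IsBasicBallPolyhedron C r)
    {F F' : Set (EuclideanSpace ℝ (Fin d))} (hF : F ∈ closedFaces C r ∪ {∅, ballPoly C r})
    (hF' : F' ∈ closedFaces C r ∪ {∅, ballPoly C r}) :
    F ∩ F' ∈ closedFaces C r ∪ {∅, ballPoly C r} := by
  have hFP := subset_ballPoly_of_mem_closedFaces hF
  have hFP' := subset_ballPoly_of_mem_closedFaces hF'
  rcases id hF with h | rfl | rfl
  · rcases id hF' with h' | rfl | rfl
    · rcases hC.inter_closedFace h h' with h2 | h2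
      · exact Or.inr (Or.inl h2)
      · exact Or.inl h2
    · rwa [inter_empty]
    · rwa [inter_eq_self_of_subset_left hFP]
  · rwa [empty_inter]
  · rwa [inter_eq_self_of_subset_right hFP']

end BasicBallPolyhedron

/-- A finite nonempty subfamily of a family of sets closed under binary intersections has its
intersection in the family. -/
lemma sInter_mem_of_inter_mem {α : Type*} {L s : Set (Set α)}
    (hL : ∀ F ∈ L, ∀ F' ∈ L, F ∩ F' ∈ L) (hs : s.Finite) (hne : s.Nonempty) (hsL : s ⊆ L) :
    ⋂₀ s ∈ L := by
  lift s to Finset (Set α) using hs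
  have := Finset.inf'_mem L hL s (Finset.coe_nonempty.1 hne) id fun F hF => hsL hF
  rwa [Finset.inf'_eq_inf, Finset.inf_id_set_eq_sInter] at this

/-- the intersection of two closed faces of a basic `r`-ball polyhedron is
empty or a closed face; consequently the closed faces together with `∅` and `P_{C,r}` form
a lattice under inclusion (meets are intersections, joins are intersections of upper bounds). -/
theorem stmt14 {d : ℕ} (hd : 2 ≤ d) (C : Set (EuclideanSpace ℝ (Fin d))) (r : ℝ)
    (hC : IsBasicBallPolyhedron C r) :
    (∀ S ⊆ C, ∀ S' ⊆ C,
      (vorF C S ∩ frontier (ballPoly C r)).Nonempty →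
      (vorF C S' ∩ frontier (ballPoly C r)).Nonempty →
      ((closure (vorF C S) ∩ frontier (ballPoly C r)) ∩
          (closure (vorF C S') ∩ frontier (ballPoly C r)) = ∅ ∨
        (closure (vorF C S) ∩ frontier (ballPoly C r)) ∩
          (closure (vorF C S') ∩ frontier (ballPoly C r)) ∈ closedFaces C r)) ∧
    (∀ F ∈ closedFaces C r ∪ {∅, ballPoly C r},
     ∀ F' ∈ closedFaces C r ∪ {∅, ballPoly C r},
      F ∩ F' ∈ closedFaces C r ∪ {∅, ballPoly C r} ∧
      ⋂₀ {G ∈ closedFaces C r ∪ {∅, ballPoly C r} | F ⊆ G ∧ F' ⊆ G} ∈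
        closedFaces C r ∪ {∅, ballPoly C r}) := by
  have hL : ∀ F ∈ closedFaces C r ∪ {∅, ballPoly C r},
      ∀ F' ∈ closedFaces C r ∪ {∅, ballPoly C r},
      F ∩ F' ∈ closedFaces C r ∪ {∅, ballPoly C r} := fun F hF F' hF' => hC.inter_mem hF hF'
  refine ⟨fun S hS S' hS' h h' => hC.inter_closedFace ⟨S, hS, h, rfl⟩ ⟨S', hS', h', rfl⟩,
    fun F hF F' hF' => ⟨hL F hF F' hF', sInter_mem_of_inter_mem hL ?_ ?_ (sep_subset _ _)⟩⟩
  · exact ((finite_closedFaces hC.2.1).union (by simp)).subset (sep_subset _ _)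
  · exact ⟨ballPoly C r, Or.inr (Or.inr rfl), subset_ballPoly_of_mem_closedFaces hF,
      subset_ballPoly_of_mem_closedFaces hF'⟩
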